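/- Let ν ≥ 0 and let (u, θ) be a smooth solution of the regularized thermoelasticity system on [0,T]. Then for every t ∈ [0,T]: ‖u_tt(t)‖_{L²}² + ‖u_tx(t)‖_{L²}² + 2ν ∫₀ᵗ ‖u_ttx(s)‖_{L²}² ds ≤ e^t ( ‖u_tt(0)‖_{L²}² + ‖u_tx(0)‖_{L²}² + μ² ∫₀ᵗ ‖θ_tx(s)‖_{L²}² ds ). -/

import Mathlib

open Set MeasureTheory

/-- Partial derivative in the first (time) variable. -/
noncomputable def pt (w : ℝ → ℝ → ℝ) (t x : ℝ) : ℝ := deriv (fun s => w s x) t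

/-- Partial derivative in the second (space) variable. -/
noncomputable def px (w : ℝ → ℝ → ℝ) (t x : ℝ) : ℝ := deriv (fun y => w t y) x

/-- Square of the L² norm on (a,b). -/
noncomputable def sqInt (a b : ℝ) (f : ℝ → ℝ) : ℝ := ∫ x in a..b, (f x) ^ 2

/-- The L² norm on (a,b). -/
noncomputable def L2norm (a b : ℝ) (f : ℝ → ℝ) : ℝ := Real.sqrt (sqInt a b f)

/-- A smooth solution of the regularized thermoelasticity system on [0,T] × [a,b]:
`u_tt − u_xx − ν u_txx = −μ θ_x`, `θ_t − θ_xx + μ θ u_tx = 0`,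
with Dirichlet boundary conditions for `u` and Neumann boundary conditions for `θ`. -/
def IsRegSolution (a b μ T ν : ℝ) (u θ : ℝ → ℝ → ℝ) : Prop :=
  ContDiff ℝ (⊤ : ℕ∞) (Function.uncurry u) ∧ ContDiff ℝ (⊤ : ℕ∞) (Function.uncurry θ) ∧
  (∀ t ∈ Set.Icc (0:ℝ) T, ∀ x ∈ Set.Icc a b,
      pt (pt u) t x - px (px u) t x - ν * px (px (pt u)) t x = -μ * px θ t x) ∧
  (∀ t ∈ Set.Icc (0:ℝ) T, ∀ x ∈ Set.Icc a b,
      pt θ t x - px (px θ) t x + μ * θ t x * px (pt u) t x = 0) ∧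
  (∀ t ∈ Set.Icc (0:ℝ) T, u t a = 0 ∧ u t b = 0) ∧
  (∀ t ∈ Set.Icc (0:ℝ) T, px θ t a = 0 ∧ px θ t b = 0)

open Function

section PartialDerivatives

variable {w : ℝ → ℝ → ℝ}

theorem pt_eq_fderiv (hw : ContDiff ℝ (⊤ : ℕ∞) (uncurry w)) (t x : ℝ) :
    pt w t x = fderiv ℝ (uncurry w) (t, x) (1, 0) := by
  have hd : HasFDerivAt (uncurry w) (fderiv ℝ (uncurry w) (t, x)) (t, x) :=
    (hw.differentiable (by simp) _).hasFDerivAt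
  have hc : HasDerivAt (fun s : ℝ => (s, x)) (1, 0) t :=
    (hasDerivAt_id t).prodMk (hasDerivAt_const t x)
  exact (hd.comp_hasDerivAt t hc).deriv

theorem px_eq_fderiv (hw : ContDiff ℝ (⊤ : ℕ∞) (uncurry w)) (t x : ℝ) :
    px w t x = fderiv ℝ (uncurry w) (t, x) (0, 1) := by
  have hd : HasFDerivAt (uncurry w) (fderiv ℝ (uncurry w) (t, x)) (t, x) :=
    (hw.differentiable (by simp) _).hasFDerivAt
  have hc : HasDerivAt (fun y : ℝ => (t, y)) (0, 1) x :=
    (hasDerivAt_const x t).prodMk (hasDerivAt_id x)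
  exact (hd.comp_hasDerivAt x hc).deriv

theorem contDiff_pt (hw : ContDiff ℝ (⊤ : ℕ∞) (uncurry w)) :
    ContDiff ℝ (⊤ : ℕ∞) (uncurry (pt w)) := by
  have h : uncurry (pt w) = fun p => fderiv ℝ (uncurry w) p (1, 0) :=
    funext fun p => pt_eq_fderiv hw p.1 p.2
  rw [h]
  exact (hw.fderiv_right (m := (⊤ : ℕ∞)) (by simp)).clm_apply contDiff_const

theorem contDiff_px (hw : ContDiff ℝ (⊤ : ℕ∞) (uncurry w)) :
    ContDiff ℝ (⊤ : ℕ∞) (uncurry (px w)) := by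
  have h : uncurry (px w) = fun p => fderiv ℝ (uncurry w) p (0, 1) :=
    funext fun p => px_eq_fderiv hw p.1 p.2
  rw [h]
  exact (hw.fderiv_right (m := (⊤ : ℕ∞)) (by simp)).clm_apply contDiff_const

theorem hasDerivAt_pt (hw : ContDiff ℝ (⊤ : ℕ∞) (uncurry w)) (t x : ℝ) :
    HasDerivAt (fun s => w s x) (pt w t x) t := by
  have h : Differentiable ℝ (fun s => uncurry w (s, x)) :=
    (hw.differentiable (by simp)).comp (by fun_prop)
  exact (h t).hasDerivAt

theorem hasDerivAt_px (hw : ContDiff ℝ (⊤ : ℕ∞) (uncurry w)) (t x : ℝ) :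
    HasDerivAt (fun y => w t y) (px w t x) x := by
  have h : Differentiable ℝ (fun y => uncurry w (t, y)) :=
    (hw.differentiable (by simp)).comp (by fun_prop)
  exact (h x).hasDerivAt

theorem pt_px_comm (hw : ContDiff ℝ (⊤ : ℕ∞) (uncurry w)) : pt (px w) = px (pt w) := by
  funext t x
  have hd : DifferentiableAt ℝ (fderiv ℝ (uncurry w)) (t, x) :=
    (hw.fderiv_right (m := (⊤ : ℕ∞)) (by simp)).differentiable (by simp) _
  have hsymm : IsSymmSndFDerivAt ℝ (uncurry w) (t, x) :=
    hw.contDiffAt.isSymmSndFDerivAt (by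
      rw [minSmoothness_of_isRCLikeNormedField]
      exact WithTop.coe_le_coe.2 (le_top : (2 : ℕ∞) ≤ ⊤))
  have hx : uncurry (px w) = fun p => fderiv ℝ (uncurry w) p (0, 1) :=
    funext fun p => px_eq_fderiv hw p.1 p.2
  have ht : uncurry (pt w) = fun p => fderiv ℝ (uncurry w) p (1, 0) :=
    funext fun p => pt_eq_fderiv hw p.1 p.2
  rw [pt_eq_fderiv (contDiff_px hw), px_eq_fderiv (contDiff_pt hw), hx, ht,
    fderiv_clm_apply hd (differentiableAt_const _), fderiv_clm_apply hd (differentiableAt_const _)]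
  simpa using hsymm.eq (1, 0) (0, 1)

/-- Functions that agree for all times in `(0, T)` have the same time derivative there. -/
theorem pt_eq_of_eq_on_Ioo {v : ℝ → ℝ → ℝ} {T x t : ℝ}
    (h : ∀ s ∈ Ioo 0 T, w s x = v s x) (ht : t ∈ Ioo 0 T) : pt w t x = pt v t x :=
  Filter.EventuallyEq.deriv_eq (Filter.mem_of_superset (isOpen_Ioo.mem_nhds ht) h)

theorem continuous_slice (hw : ContDiff ℝ (⊤ : ℕ∞) (uncurry w)) (t : ℝ) : Continuous (w t) :=
  hw.continuous.comp (Continuous.prodMk_right t)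

theorem continuous_sqInt (a b : ℝ) (hw : ContDiff ℝ (⊤ : ℕ∞) (uncurry w)) :
    Continuous fun s => sqInt a b (w s) :=
  intervalIntegral.continuous_parametric_intervalIntegral_of_continuous'
    (f := fun s x => w s x ^ 2) (hw.continuous.fun_pow 2) a b

theorem hasDerivAt_sqInt (a b : ℝ) (hw : ContDiff ℝ (⊤ : ℕ∞) (uncurry w)) (t : ℝ) :
    HasDerivAt (fun s => sqInt a b (w s)) (∫ x in a..b, 2 * w t x * pt w t x) t := by
  have hF' : Continuous fun p : ℝ × ℝ => 2 * uncurry w p * uncurry (pt w) p :=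
    (continuous_const.mul hw.continuous).mul (contDiff_pt hw).continuous
  obtain ⟨C, hC⟩ := ((isCompact_closedBall t 1).prod (isCompact_uIcc (a := a) (b := b))
    ).exists_bound_of_continuousOn hF'.continuousOn
  refine (intervalIntegral.hasDerivAt_integral_of_dominated_loc_of_deriv_le
    (F := fun s x => w s x ^ 2) (F' := fun s x => 2 * w s x * pt w s x) (bound := fun _ => C)
    (Metric.closedBall_mem_nhds t one_pos) ?_ ?_ ?_ ?_ ?_ ?_).2
  · exact .of_forall fun s => ((continuous_slice hw s).pow 2).aestronglyMeasurable
  · exact ((continuous_slice hw t).pow 2).intervalIntegrable _ _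
  · exact (hF'.comp (Continuous.prodMk_right t)).aestronglyMeasurable
  · exact .of_forall fun x hx s hs => hC (s, x) ⟨hs, uIoc_subset_uIcc hx⟩
  · exact intervalIntegrable_const
  · refine .of_forall fun x _ s _ => ?_
    simpa using (hasDerivAt_pt hw s x).fun_pow 2

end PartialDerivatives

/-- Grönwall's inequality in the form `F' ≤ F + g ⟹ F(t) ≤ eᵗ (F(0) + ∫₀ᵗ g)`, for `g ≥ 0`. -/
theorem le_exp_mul_of_hasDerivAt_le {F F' g : ℝ → ℝ} {T : ℝ} (hF : ∀ t, HasDerivAt F (F' t) t)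
    (hg : Continuous g) (hg0 : ∀ t, 0 ≤ g t) (hle : ∀ t ∈ Ioo 0 T, F' t ≤ F t + g t)
    {t : ℝ} (ht : t ∈ Icc 0 T) :
    F t ≤ Real.exp t * (F 0 + ∫ s in (0 : ℝ)..t, g s) := by
  have hder : ∀ s, HasDerivAt (fun s => Real.exp (-s) * F s - ∫ r in (0 : ℝ)..s, g r)
      (-Real.exp (-s) * F s + Real.exp (-s) * F' s - g s) s := fun s => by
    have he : HasDerivAt (fun s => Real.exp (-s)) (-Real.exp (-s)) s := by
      simpa using (hasDerivAt_neg s).exp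
    exact (he.mul (hF s)).sub (hg.integral_hasStrictDerivAt 0 s).hasDerivAt
  have hanti := antitoneOn_of_hasDerivWithinAt_nonpos (convex_Icc 0 T)
    (fun s _ => (hder s).continuousAt.continuousWithinAt)
    (fun s _ => (hder s).hasDerivWithinAt) (fun s hs => by
      rw [interior_Icc] at hs
      have h1 : Real.exp (-s) ≤ 1 := Real.exp_le_one_iff.2 (by linarith [hs.1])
      have h2 := mul_le_mul_of_nonneg_left (hle s hs) (Real.exp_pos (-s)).le
      have h3 := mul_le_mul_of_nonneg_right h1 (hg0 s)
      linarith)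
  have h := hanti (left_mem_Icc.2 (ht.1.trans ht.2)) ht ht.1
  simp only [neg_zero, Real.exp_zero, one_mul, intervalIntegral.integral_same, sub_zero] at h
  calc F t = Real.exp t * (Real.exp (-t) * F t) := by
        rw [← mul_assoc, ← Real.exp_add]; simp
    _ ≤ _ := mul_le_mul_of_nonneg_left (by linarith) (Real.exp_pos t).le

section Solution

variable {a b μ T ν : ℝ} {u θ : ℝ → ℝ → ℝ}

/-- The elastic equation differentiated in time: `u_ttt = u_txx + ν u_ttxx - μ θ_tx`. -/
theorem IsRegSolution.pt_elastic (hsol : IsRegSolution a b μ T ν u θ) {t x : ℝ}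
    (ht : t ∈ Ioo 0 T) (hx : x ∈ Icc a b) :
    pt (pt (pt u)) t x
      = px (px (pt u)) t x + ν * px (px (pt (pt u))) t x - μ * px (pt θ) t x := by
  obtain ⟨hu, hθ, heq, -⟩ := hsol
  have h := pt_eq_of_eq_on_Ioo (w := pt (pt u))
    (v := fun s y => px (px u) s y + ν * px (px (pt u)) s y - μ * px θ s y)
    (fun s hs => by linarith [heq s (Ioo_subset_Icc_self hs) x hx]) ht
  rw [← pt_px_comm hθ, ← pt_px_comm hu, ← pt_px_comm (contDiff_px hu),
    ← pt_px_comm (contDiff_pt hu), ← pt_px_comm (contDiff_px (contDiff_pt hu)), h]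
  exact (((hasDerivAt_pt (contDiff_px (contDiff_px hu)) t x).fun_add
    ((hasDerivAt_pt (contDiff_px (contDiff_px (contDiff_pt hu))) t x).const_mul ν)).fun_sub
    ((hasDerivAt_pt (contDiff_px hθ) t x).const_mul μ)).deriv

theorem pt_pt_eq_zero {x : ℝ} (h : ∀ t ∈ Icc (0 : ℝ) T, u t x = 0) {t : ℝ}
    (ht : t ∈ Ioo 0 T) : pt (pt u) t x = 0 := by
  have h1 : ∀ s ∈ Ioo 0 T, pt u s x = 0 := fun s hs => by
    rw [pt_eq_of_eq_on_Ioo (v := fun _ _ => 0) (fun r hr => h r (Ioo_subset_Icc_self hr)) hs]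
    simp [pt]
  rw [pt_eq_of_eq_on_Ioo (v := fun _ _ => 0) h1 ht]
  simp [pt]

/-- The energy inequality for the differentiated elastic equation tested with `u_tt`. -/
theorem IsRegSolution.energy_deriv_le (hsol : IsRegSolution a b μ T ν u θ) (hab : a ≤ b) {t : ℝ}
    (ht : t ∈ Ioo 0 T) :
    (∫ x in a..b, 2 * pt (pt u) t x * pt (pt (pt u)) t x)
        + (∫ x in a..b, 2 * px (pt u) t x * pt (px (pt u)) t x)
        + 2 * ν * sqInt a b (px (pt (pt u)) t)
      ≤ sqInt a b (pt (pt u) t) + μ ^ 2 * sqInt a b (px (pt θ) t) := by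
  have hB := contDiff_px (contDiff_pt hsol.1)
  have hA := contDiff_pt (contDiff_pt hsol.1)
  have hD := contDiff_px hA
  have cA := continuous_slice hA t
  have cA' := continuous_slice (contDiff_pt hA) t
  have cB := continuous_slice hB t
  have cB' := continuous_slice (contDiff_px hB) t
  have cD := continuous_slice hD t
  have cD' := continuous_slice (contDiff_px hD) t
  have cG := continuous_slice (contDiff_px (contDiff_pt hsol.2.1)) t
  rw [pt_px_comm (contDiff_pt hsol.1)]
  have hparts : ∫ x in a..b, (px (pt (pt u)) t x * (px (pt u) t x + ν * px (pt (pt u)) t x)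
      + pt (pt u) t x * (px (px (pt u)) t x + ν * px (px (pt (pt u))) t x)) = 0 := by
    rw [intervalIntegral.integral_deriv_mul_eq_sub
      (fun x _ => hasDerivAt_px hA t x)
      (fun x _ => (hasDerivAt_px hB t x).fun_add ((hasDerivAt_px hD t x).const_mul ν))
      (cD.intervalIntegrable _ _) ((cB'.add (cD'.const_mul ν)).intervalIntegrable _ _),
      pt_pt_eq_zero (fun s hs => (hsol.2.2.2.2.1 s hs).1) ht,
      pt_pt_eq_zero (fun s hs => (hsol.2.2.2.2.1 s hs).2) ht]
    ring
  have hmono : (∫ x in a..b, (2 * pt (pt u) t x * pt (pt (pt u)) t x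
        + 2 * px (pt u) t x * px (pt (pt u)) t x + 2 * ν * px (pt (pt u)) t x ^ 2))
      ≤ ∫ x in a..b, (2 * (px (pt (pt u)) t x * (px (pt u) t x + ν * px (pt (pt u)) t x)
        + pt (pt u) t x * (px (px (pt u)) t x + ν * px (px (pt (pt u))) t x))
        + (pt (pt u) t x ^ 2 + μ ^ 2 * px (pt θ) t x ^ 2)) := by
    refine intervalIntegral.integral_mono_on hab
      (Continuous.intervalIntegrable (by fun_prop) _ _)
      (Continuous.intervalIntegrable (by fun_prop) _ _) fun x hx => ?_
    rw [hsol.pt_elastic ht hx]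
    linarith [sq_nonneg (pt (pt u) t x + μ * px (pt θ) t x)]
  rw [intervalIntegral.integral_add (Continuous.intervalIntegrable (by fun_prop) _ _)
      (Continuous.intervalIntegrable (by fun_prop) _ _),
    intervalIntegral.integral_add (Continuous.intervalIntegrable (by fun_prop) _ _)
      (Continuous.intervalIntegrable (by fun_prop) _ _),
    intervalIntegral.integral_add (Continuous.intervalIntegrable (by fun_prop) _ _)
      (Continuous.intervalIntegrable (by fun_prop) _ _),
    intervalIntegral.integral_add (Continuous.intervalIntegrable (by fun_prop) _ _)
      (Continuous.intervalIntegrable (by fun_prop) _ _),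
    intervalIntegral.integral_const_mul, intervalIntegral.integral_const_mul,
    intervalIntegral.integral_const_mul, hparts] at hmono
  simpa only [sqInt, mul_zero, zero_add] using hmono

end Solution

/-- **Second-order energy estimate**: for every `t ∈ [0,T]`,
`‖u_tt(t)‖² + ‖u_tx(t)‖² + 2ν ∫₀ᵗ ‖u_ttx‖²
  ≤ eᵗ (‖u_tt(0)‖² + ‖u_tx(0)‖² + μ² ∫₀ᵗ ‖θ_tx‖²)`. -/
theorem second_order_energy_estimate (a b μ T ν : ℝ) (hab : a < b) (hμ : 0 < μ) (hT : 0 < T)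
    (hν : 0 ≤ ν) (u θ : ℝ → ℝ → ℝ) (hsol : IsRegSolution a b μ T ν u θ) :
    ∀ t ∈ Icc (0:ℝ) T,
      sqInt a b (fun x => pt (pt u) t x) + sqInt a b (fun x => px (pt u) t x)
          + 2 * ν * ∫ s in (0:ℝ)..t, sqInt a b (fun x => px (pt (pt u)) s x)
        ≤ Real.exp t * (sqInt a b (fun x => pt (pt u) 0 x) + sqInt a b (fun x => px (pt u) 0 x)
          + μ ^ 2 * ∫ s in (0:ℝ)..t, sqInt a b (fun x => px (pt θ) s x)) := by
  intro t ht
  have hu := hsol.1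
  have hA := contDiff_pt (contDiff_pt hu)
  have hB := contDiff_px (contDiff_pt hu)
  have hD := continuous_sqInt a b (contDiff_px hA)
  have hG := continuous_sqInt a b (contDiff_px (contDiff_pt hsol.2.1))
  have hnn : ∀ (w : ℝ → ℝ → ℝ) (s : ℝ), 0 ≤ sqInt a b (w s) := fun w s =>
    intervalIntegral.integral_nonneg hab.le fun x _ => sq_nonneg _
  have h := le_exp_mul_of_hasDerivAt_le (T := T)
    (F := fun t => sqInt a b (pt (pt u) t) + sqInt a b (px (pt u) t)
      + 2 * ν * ∫ s in (0 : ℝ)..t, sqInt a b (px (pt (pt u)) s))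
    (g := fun s => μ ^ 2 * sqInt a b (px (pt θ) s))
    (fun s => ((hasDerivAt_sqInt a b hA s).add (hasDerivAt_sqInt a b hB s)).add
      ((hD.integral_hasStrictDerivAt 0 s).hasDerivAt.const_mul (2 * ν)))
    (hG.const_mul _) (fun s => mul_nonneg (sq_nonneg μ) (hnn _ s))
    (fun s hs => by
      have hdiss : 0 ≤ 2 * ν * ∫ r in (0 : ℝ)..s, sqInt a b (px (pt (pt u)) r) :=
        mul_nonneg (by linarith)
          (intervalIntegral.integral_nonneg hs.1.le fun r _ => hnn _ r)
      linarith [hsol.energy_deriv_le hab.le hs, hnn (px (pt u)) s]) ht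
  simpa only [intervalIntegral.integral_const_mul, intervalIntegral.integral_same, mul_zero,
    add_zero] using h
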